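/- Fix n ≥ 1 and k ≥ 1. For any two target indices i, j ∈ {1,…,n}, the distribution of the redacted multiset obtained by sampling a size-k multiset uniformly among those containing i and removing one copy of i is identical to the distribution obtained by sampling a size-k multiset uniformly among those containing j and removing one copy of j; both equal the uniform distribution on size-(k−1) multisets over {1,…,n}. -/

import Mathlib

/-- The finset of all size-`k` multisets over `Fin n`. -/
noncomputable def multisetsCard (n k : ℕ) : Finset (Multiset (Fin n)) :=
  (Finset.univ : Finset (Sym (Fin n) k)).image Sym.toMultiset

/-- `R_i`: the finset of size-`k` multisets over `Fin n` containing at least one copy of `i`. -/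
noncomputable def coveringHints (n k : ℕ) (i : Fin n) : Finset (Multiset (Fin n)) :=
  (multisetsCard n k).filter (fun H => i ∈ H)

lemma multisetsCard_nonempty (n k : ℕ) (hn : 1 ≤ n) : (multisetsCard n k).Nonempty := by
  refine ⟨Multiset.replicate k ⟨0, hn⟩, ?_⟩
  simp [multisetsCard]
  exact ⟨⟨Multiset.replicate k ⟨0, hn⟩, by simp⟩, rfl⟩

lemma coveringHints_nonempty (n k : ℕ) (hk : 1 ≤ k) (i : Fin n) :
    (coveringHints n k i).Nonempty := by
  refine ⟨Multiset.replicate k i, ?_⟩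
  simp [coveringHints, multisetsCard, Multiset.mem_replicate]
  constructor
  · exact ⟨⟨Multiset.replicate k i, by simp⟩, rfl⟩
  · omega

lemma mem_multisetsCard_iff (n k : ℕ) (H : Multiset (Fin n)) :
    H ∈ multisetsCard n k ↔ Multiset.card H = k := by
  unfold multisetsCard
  rw [Finset.mem_image]
  constructor
  · rintro ⟨s, -, rfl⟩
    exact s.2
  · intro h
    exact ⟨⟨H, h⟩, Finset.mem_univ _, rfl⟩

lemma mem_coveringHints_iff (n k : ℕ) (i : Fin n) (H : Multiset (Fin n)) :
    H ∈ coveringHints n k i ↔ Multiset.card H = k ∧ i ∈ H := by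
  unfold coveringHints
  rw [Finset.mem_filter, mem_multisetsCard_iff]

lemma cons_mem_coveringHints_iff (n k : ℕ) (hk : 1 ≤ k) (i : Fin n) (M : Multiset (Fin n)) :
    i ::ₘ M ∈ coveringHints n k i ↔ M ∈ multisetsCard n (k - 1) := by
  rw [mem_coveringHints_iff, mem_multisetsCard_iff, Multiset.card_cons]
  simp only [Multiset.mem_cons_self, and_true]
  omega

lemma card_coveringHints_eq (n k : ℕ) (hk : 1 ≤ k) (i : Fin n) :
    (coveringHints n k i).card = (multisetsCard n (k - 1)).card := by
  symm
  apply Finset.card_bij (fun M _ => i ::ₘ M)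
  · intro M hM
    exact (cons_mem_coveringHints_iff n k hk i M).2 hM
  · intro a _ b _ h
    exact (Multiset.cons_inj_right i).1 h
  · intro H hH
    have hi := ((mem_coveringHints_iff n k i H).1 hH).2
    refine ⟨H.erase i, ?_, Multiset.cons_erase hi⟩
    rw [← cons_mem_coveringHints_iff n k hk i, Multiset.cons_erase hi]
    exact hH

lemma map_erase_eq_uniform (n k : ℕ) (hn : 1 ≤ n) (hk : 1 ≤ k) (i : Fin n) :
    (PMF.uniformOfFinset (coveringHints n k i) (coveringHints_nonempty n k hk i)).map
        (fun H => H.erase i)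
      = PMF.uniformOfFinset (multisetsCard n (k - 1))
          (multisetsCard_nonempty n (k - 1) hn) := by
  ext M
  rw [PMF.map_apply, tsum_eq_single (i ::ₘ M)]
  · rw [if_pos (by simp), PMF.uniformOfFinset_apply, PMF.uniformOfFinset_apply,
      card_coveringHints_eq n k hk i]
    simp only [cons_mem_coveringHints_iff n k hk i]
    congr
  · intro H hH
    split_ifs with h
    · apply PMF.uniformOfFinset_apply_of_notMem
      intro hm
      apply hH
      rw [h, Multiset.cons_erase ((mem_coveringHints_iff n k i H).1 hm).2]
    · rfl

/-- **One-query privacy.** For any two targets `i, j`, the distribution of the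
redacted multiset (uniform size-`k` multiset containing the target, with one copy
of the target removed) is the same, and equals the uniform distribution on
size-`(k−1)` multisets over `{1,…,n}`. -/
theorem redaction_target_independent (n k : ℕ) (hn : 1 ≤ n) (hk : 1 ≤ k) (i j : Fin n) :
    (PMF.uniformOfFinset (coveringHints n k i) (coveringHints_nonempty n k hk i)).map
        (fun H => H.erase i)
      = (PMF.uniformOfFinset (coveringHints n k j) (coveringHints_nonempty n k hk j)).map
          (fun H => H.erase j) ∧
    (PMF.uniformOfFinset (coveringHints n k i) (coveringHints_nonempty n k hk i)).map
        (fun H => H.erase i)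
      = PMF.uniformOfFinset (multisetsCard n (k - 1))
          (multisetsCard_nonempty n (k - 1) hn) := by
  exact ⟨(map_erase_eq_uniform n k hn hk i).trans (map_erase_eq_uniform n k hn hk j).symm,
    map_erase_eq_uniform n k hn hk i⟩
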